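/- arXiv:2003.01844 — 2 statements merged into one kernel-verified Lean document; each statement's English description precedes it below -/
import Mathlib

section
/- Theorem: If A and B ∈ ARI(Γ) are push-invariant and swap(A), swap(B) are pus-neutral, then ari_u(A,B) is push-invariant and swap(ari_u(A,B)) is pus-neutral; consequently the set ARI(Γ)_{push/pusnu} of push-invariant moulds with pus-neutral swap is a Lie subalgebra of (ARI(Γ), ari_u). -/
namespace KVMould

/-- A mould over `Γ` in evaluation form: the depth-`m` component
`M m σ x` is the value of the rational function `M^m_{σ₁,…,σₘ}` at the
rational point `x = (x₁,…,xₘ)` (indices are 0-based). -/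
abbrev Mould (Γ : Type) : Type := (m : ℕ) → (Fin m → Γ) → (Fin m → ℚ) → ℚ

variable {Γ : Type} [CommGroup Γ]

/-- `M ∈ ARI(Γ)`: the depth `0` component vanishes. -/
def IsARI (M : Mould Γ) : Prop := ∀ σ x, M 0 σ x = 0

/-- Extension of a tuple of rationals by `0` outside the range. -/
def extQ {m : ℕ} (x : Fin m → ℚ) : ℕ → ℚ := fun i => if h : i < m then x ⟨i, h⟩ else 0

/-- Extension of a tuple of group elements by `1` outside the range. -/
def extG {m : ℕ} (σ : Fin m → Γ) : ℕ → Γ := fun i => if h : i < m then σ ⟨i, h⟩ else 1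

/-- The (noncommutative, nonunital on `ARI`) mould product `A × B`. -/
def mouldMul (A B : Mould Γ) : Mould Γ := fun m σ x =>
  ∑ k ∈ Finset.range (m + 1),
    A k (fun j => extG σ j.val) (fun j => extQ x j.val) *
      B (m - k) (fun j => extG σ (k + j.val)) (fun j => extQ x (k + j.val))

/-- Ecalle's derivation `arit_u(B)(A)` (0-indexed form of the paper's
Definition of `arit_u`; the blocks `k ≤ l` below are 0-based). -/
def aritU (B A : Mould Γ) : Mould Γ := fun m σ x =>
  (∑ k ∈ Finset.range m, ∑ l ∈ Finset.range m,
    if k ≤ l ∧ l + 1 < m then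
      A (m - (l - k + 1))
        (fun j => if j.val < k then extG σ j.val
          else if j.val = k then extG σ (l + 1)
          else extG σ (j.val + (l - k + 1)))
        (fun j => if j.val < k then extQ x j.val
          else if j.val = k then ∑ i ∈ Finset.Icc k (l + 1), extQ x i
          else extQ x (j.val + (l - k + 1))) *
      B (l - k + 1)
        (fun j => extG σ (k + j.val) * (extG σ (l + 1))⁻¹)
        (fun j => extQ x (k + j.val))
    else 0)
  -
  (∑ k ∈ Finset.range m, ∑ l ∈ Finset.range m,
    if 1 ≤ k ∧ k ≤ l then
      A (m - (l - k + 1))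
        (fun j => if j.val < k - 1 then extG σ j.val
          else if j.val = k - 1 then extG σ (k - 1)
          else extG σ (j.val + (l - k + 1)))
        (fun j => if j.val < k - 1 then extQ x j.val
          else if j.val = k - 1 then ∑ i ∈ Finset.Icc (k - 1) l, extQ x i
          else extQ x (j.val + (l - k + 1))) *
      B (l - k + 1)
        (fun j => extG σ (k + j.val) * (extG σ (k - 1))⁻¹)
        (fun j => extQ x (k + j.val))
    else 0)

/-- The `ari_u`-bracket: `ari_u(A,B) = arit_u(B)(A) − arit_u(A)(B) + A×B − B×A`. -/
def ariU (A B : Mould Γ) : Mould Γ :=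
  aritU B A - aritU A B + mouldMul A B - mouldMul B A

/-- `preari_u(A,B) = arit_u(B)(A) + A×B`. -/
def preariU (A B : Mould Γ) : Mould Γ := aritU B A + mouldMul A B

/-- The set of shuffle permutations `Sh(p,q)`. -/
def shuffles (p q : ℕ) : Finset (Equiv.Perm (Fin (p + q))) :=
  Finset.univ.filter fun τ =>
    (∀ i j : Fin (p + q), i.val < j.val → j.val < p → τ⁻¹ i < τ⁻¹ j) ∧
    (∀ i j : Fin (p + q), i.val < j.val → p ≤ i.val → τ⁻¹ i < τ⁻¹ j)

/-- Alternality of a mould. -/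
def IsAlternal (M : Mould Γ) : Prop :=
  ∀ p q : ℕ, 1 ≤ p → 1 ≤ q → ∀ (σ : Fin (p + q) → Γ) (x : Fin (p + q) → ℚ),
    ∑ τ ∈ shuffles p q, M (p + q) (fun i => σ (τ i)) (fun i => x (τ i)) = 0

/-- The `swap` of a mould. -/
def swapM (M : Mould Γ) : Mould Γ := fun m σ v =>
  M m (fun i => ∏ j ∈ Finset.range (m - i.val), extG σ j)
    (fun i => extQ v (m - 1 - i.val) - extQ v (m - i.val))

/-- Bialternality: `M` and `swap(M)` are alternal and the depth `1`
component is even (`M¹(x₁;σ₁) = M¹(−x₁;σ₁⁻¹)`). -/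
def IsBialternal (M : Mould Γ) : Prop :=
  IsAlternal M ∧ IsAlternal (swapM M) ∧
    ∀ (σ : Γ) (t : ℚ), M 1 (fun _ => σ) (fun _ => t) = M 1 (fun _ => σ⁻¹) (fun _ => -t)

/-- The `push` operator. -/
def pushM (M : Mould Γ) : Mould Γ := fun m σ x =>
  M m
    (fun i => if i.val = 0 then (extG σ (m - 1))⁻¹
      else extG σ (i.val - 1) * (extG σ (m - 1))⁻¹)
    (fun i => if i.val = 0 then -(∑ j ∈ Finset.range m, extQ x j)
      else extQ x (i.val - 1))

/-- The `v`-variant `arit_v(B)(A)`. -/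
def aritV (B A : Mould Γ) : Mould Γ := fun m σ v =>
  (∑ k ∈ Finset.range m, ∑ l ∈ Finset.range m,
    if k ≤ l ∧ l + 1 < m then
      A (m - (l - k + 1))
        (fun j => if j.val < k then extG σ j.val
          else if j.val = k then ∏ i ∈ Finset.Icc k (l + 1), extG σ i
          else extG σ (j.val + (l - k + 1)))
        (fun j => if j.val < k then extQ v j.val
          else if j.val = k then extQ v (l + 1)
          else extQ v (j.val + (l - k + 1))) *
      B (l - k + 1)
        (fun j => extG σ (k + j.val))
        (fun j => extQ v (k + j.val) - extQ v (l + 1))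
    else 0)
  -
  (∑ k ∈ Finset.range m, ∑ l ∈ Finset.range m,
    if 1 ≤ k ∧ k ≤ l then
      A (m - (l - k + 1))
        (fun j => if j.val < k - 1 then extG σ j.val
          else if j.val = k - 1 then ∏ i ∈ Finset.Icc (k - 1) l, extG σ i
          else extG σ (j.val + (l - k + 1)))
        (fun j => if j.val < k - 1 then extQ v j.val
          else if j.val = k - 1 then extQ v (k - 1)
          else extQ v (j.val + (l - k + 1))) *
      B (l - k + 1)
        (fun j => extG σ (k + j.val))
        (fun j => extQ v (k + j.val) - extQ v (k - 1))
    else 0)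

/-- The `ari_v`-bracket. -/
def ariV (A B : Mould Γ) : Mould Γ :=
  aritV B A - aritV A B + mouldMul A B - mouldMul B A

/-- Pus-neutrality: all cyclic shifts of every component sum to zero. -/
def IsPusNeutral (N : Mould Γ) : Prop :=
  ∀ m : ℕ, 1 ≤ m → ∀ (σ : Fin m → Γ) (v : Fin m → ℚ),
    ∑ i ∈ Finset.range m,
      N m (fun j => extG σ ((i + j.val) % m)) (fun j => extQ v ((i + j.val) % m)) = 0

/-- The subgroup `Γ^N = {g^N : g ∈ Γ}`. -/
def powSubgroup (Γ : Type) [CommGroup Γ] (N : ℕ) : Subgroup Γ :=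
  MonoidHom.range (powMonoidHom N)

/-- The map `i_N : ARI(Γ) → ARI(Γ^N)` (restriction of indices). -/
def iN (N : ℕ) (M : Mould Γ) : Mould (powSubgroup Γ N) := fun m σ x =>
  M m (fun i => (σ i : Γ)) x

/-- The map `m_N : ARI(Γ) → ARI(Γ^N)`. -/
def mN [Fintype Γ] [DecidableEq Γ] (N : ℕ) (M : Mould Γ) :
    Mould (powSubgroup Γ N) := fun m σ x =>
  ∑ τ ∈ Finset.univ.filter (fun τ : Fin m → Γ => ∀ i, τ i ^ N = (σ i : Γ)),
    M m τ (fun i => (N : ℚ) * x i)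

/-- `M` satisfies the distribution relations. -/
def IsARID [Fintype Γ] [DecidableEq Γ] (M : Mould Γ) : Prop :=
  ∀ N : ℕ, 1 ≤ N → N ∣ Fintype.card Γ → iN N M = mN N M

/-- The parallel translation map `t`. -/
def tMap (P : Mould Γ) : Mould Γ := fun m σ v =>
  if m ≤ 1 then P m σ v
  else P (m - 1) (fun j => extG σ (j.val + 1)) (fun j => extQ v (j.val + 1) - extQ v 0)

/-- `ũ := t ∘ swap`. -/
def uTilde (M : Mould Γ) : Mould Γ := tMap (swapM M)

/-- Evaluation of a mould on the initial segments of two infinite sequences. -/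
def seqEval (M : Mould Γ) (n : ℕ) (σ : ℕ → Γ) (x : ℕ → ℚ) : ℚ :=
  M n (fun j => σ j.val) (fun j => x j.val)

theorem eq_seqEval {G : Type} (M : Mould G) {n n' : ℕ} {σ : Fin n → G} {σ' : ℕ → G} {x : Fin n → ℚ}
    {x' : ℕ → ℚ} (hn : n = n') (hσ : ∀ (j : ℕ) (hj : j < n), σ ⟨j, hj⟩ = σ' j)
    (hx : ∀ (j : ℕ) (hj : j < n), x ⟨j, hj⟩ = x' j) : M n σ x = seqEval M n' σ' x' := by
  subst hn
  unfold seqEval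
  congr 1
  · funext j; exact hσ j j.2
  · funext j; exact hx j j.2

theorem seqEval_congr {G : Type} (M : Mould G) {n n' : ℕ} {σ σ' : ℕ → G} {x x' : ℕ → ℚ}
    (hn : n = n') (hσ : ∀ j < n, σ j = σ' j) (hx : ∀ j < n, x j = x' j) :
    seqEval M n σ x = seqEval M n' σ' x' := by
  subst hn
  unfold seqEval
  congr 1
  · funext j; exact hσ j j.2
  · funext j; exact hx j j.2

/-- The mould `M` in potential coordinates: a function of a polygon with vertices `y 0, …, y n`
and labels `t 0, …, t n`, both taken up to translation. -/
def polyEval (M : Mould Γ) (n : ℕ) (y : ℕ → ℚ) (t : ℕ → Γ) : ℚ :=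
  seqEval M n (fun j => t (j + 1) * (t 0)⁻¹) (fun j => y (j + 1) - y j)

theorem polyEval_congr_smul (M : Mould Γ) {n : ℕ} {y y' : ℕ → ℚ} {t t' : ℕ → Γ} (g : Γ)
    (hy : ∀ j ≤ n, y j = y' j) (ht : ∀ j ≤ n, t j = t' j * g) :
    polyEval M n y t = polyEval M n y' t' := by
  refine seqEval_congr M rfl (fun j hj => ?_) (fun j hj => ?_)
  · rw [ht _ (Nat.succ_le_of_lt hj), ht 0 (Nat.zero_le _)]; group
  · rw [hy _ (Nat.succ_le_of_lt hj), hy _ hj.le]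

theorem polyEval_congr (M : Mould Γ) {n : ℕ} {y y' : ℕ → ℚ} {t t' : ℕ → Γ}
    (hy : ∀ j ≤ n, y j = y' j) (ht : ∀ j ≤ n, t j = t' j) :
    polyEval M n y t = polyEval M n y' t' :=
  polyEval_congr_smul M 1 hy (fun j hj => by rw [ht j hj, mul_one])

theorem polyEval_zero {M : Mould Γ} (hM : IsARI M) (y : ℕ → ℚ) (t : ℕ → Γ) :
    polyEval M 0 y t = 0 := hM _ _

/-- The sequence `a, f 0, f 1, …`. -/
def seqCons {α : Type*} (a : α) (f : ℕ → α) : ℕ → α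
  | 0 => a
  | n + 1 => f n

@[simp] theorem seqCons_zero {α : Type*} (a : α) (f : ℕ → α) : seqCons a f 0 = a := rfl

@[simp] theorem seqCons_succ {α : Type*} (a : α) (f : ℕ → α) (n : ℕ) :
    seqCons a f (n + 1) = f n := rfl

/-- The sequence `f` with its initial term replaced by `a`. -/
def rebase {α : Type*} (a : α) (f : ℕ → α) : ℕ → α := fun j => if j = 0 then a else f j

/-- The index map which skips the block `k + 1, …, k + b`. -/
def skip (b k j : ℕ) : ℕ := if j ≤ k then j else j + b

theorem extQ_of_lt {m i : ℕ} (f : ℕ → ℚ) (h : i < m) :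
    extQ (fun j : Fin m => f j.val) i = f i := by simp [extQ, h]

theorem extG_of_lt {m i : ℕ} (f : ℕ → Γ) (h : i < m) :
    extG (fun j : Fin m => f j.val) i = f i := by simp [extG, h]

theorem eq_polyEval (M : Mould Γ) (m : ℕ) (σ : Fin m → Γ) (x : Fin m → ℚ) :
    M m σ x = polyEval M m (fun j => ∑ i ∈ Finset.range j, extQ x i) (seqCons 1 (extG σ)) := by
  unfold polyEval seqEval
  congr 1
  · funext j; simp [extG]
  · funext j; simp [Finset.sum_range_succ, extQ]

theorem sum_Icc_sub (y : ℕ → ℚ) (k l : ℕ) (h : k ≤ l + 1) :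
    ∑ i ∈ Finset.Icc k l, (y (i + 1) - y i) = y (l + 1) - y k := by
  rw [← Finset.Ico_add_one_right_eq_Icc, Finset.sum_Ico_eq_sub _ h, Finset.sum_range_sub,
    Finset.sum_range_sub]
  ring

theorem sum_blocks (m : ℕ) (F : ℕ → ℕ → ℚ) :
    (∑ k ∈ Finset.range m, ∑ l ∈ Finset.range m, if k ≤ l ∧ l + 1 < m then F k l else 0) =
      ∑ b ∈ Finset.Ico 1 m, ∑ k ∈ Finset.range (m - b), F k (k + b - 1) := by
  rw [← Finset.sum_product', ← Finset.sum_filter, Finset.sum_sigma']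
  refine Finset.sum_bij' (fun p _ => ⟨p.2 - p.1 + 1, p.1⟩) (fun p _ => (p.2, p.2 + p.1 - 1))
    ?_ ?_ ?_ ?_ ?_
  · rintro ⟨k, l⟩ h
    simp only [Finset.mem_filter, Finset.mem_product, Finset.mem_range, Finset.mem_sigma,
      Finset.mem_Ico] at h ⊢
    omega
  · rintro ⟨b, k⟩ h
    simp only [Finset.mem_filter, Finset.mem_product, Finset.mem_range, Finset.mem_sigma,
      Finset.mem_Ico] at h ⊢
    omega
  · rintro ⟨k, l⟩ h
    simp only [Finset.mem_filter, Finset.mem_product, Finset.mem_range] at h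
    simp only [Prod.mk.injEq, true_and]
    omega
  · rintro ⟨b, k⟩ h
    simp only [Finset.mem_range, Finset.mem_sigma, Finset.mem_Ico] at h
    simp only [Sigma.mk.injEq, heq_eq_eq, and_true]
    omega
  · rintro ⟨k, l⟩ h
    simp only [Finset.mem_filter, Finset.mem_product, Finset.mem_range] at h
    congr 1
    show l = k + (l - k + 1) - 1
    omega

theorem sum_blocks_succ (m : ℕ) (F : ℕ → ℕ → ℚ) :
    (∑ k ∈ Finset.range m, ∑ l ∈ Finset.range m, if 1 ≤ k ∧ k ≤ l then F k l else 0) =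
      ∑ b ∈ Finset.Ico 1 m, ∑ k ∈ Finset.range (m - b), F (k + 1) (k + b) := by
  rw [← Finset.sum_product', ← Finset.sum_filter, Finset.sum_sigma']
  refine Finset.sum_bij' (fun p _ => ⟨p.2 - p.1 + 1, p.1 - 1⟩) (fun p _ => (p.2 + 1, p.2 + p.1))
    ?_ ?_ ?_ ?_ ?_
  · rintro ⟨k, l⟩ h
    simp only [Finset.mem_filter, Finset.mem_product, Finset.mem_range, Finset.mem_sigma,
      Finset.mem_Ico] at h ⊢
    omega
  · rintro ⟨b, k⟩ h
    simp only [Finset.mem_filter, Finset.mem_product, Finset.mem_range, Finset.mem_sigma,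
      Finset.mem_Ico] at h ⊢
    omega
  · rintro ⟨k, l⟩ h
    simp only [Finset.mem_filter, Finset.mem_product, Finset.mem_range] at h
    simp only [Prod.mk.injEq]
    omega
  · rintro ⟨b, k⟩ h
    simp only [Finset.mem_range, Finset.mem_sigma, Finset.mem_Ico] at h
    simp only [Sigma.mk.injEq, heq_eq_eq]
    omega
  · rintro ⟨k, l⟩ h
    simp only [Finset.mem_filter, Finset.mem_product, Finset.mem_range] at h
    congr 1
    · show k = k - 1 + 1
      omega
    · show l = k - 1 + (l - k + 1)
      omega

/-- A block followed by its centre: the inner factor `N` lives on the block of length `b`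
starting at the vertex `k`, based at the next label. -/
def rightTerm (M N : Mould Γ) (m b k : ℕ) (y : ℕ → ℚ) (t : ℕ → Γ) : ℚ :=
  polyEval M (m - b) (fun j => y (skip b k j)) (fun j => t (skip b k j)) *
    polyEval N b (fun j => y (k + j)) (rebase (t (k + b + 1)) fun j => t (k + j))

/-- A block preceded by its centre. -/
def leftTerm (M N : Mould Γ) (m b k : ℕ) (y : ℕ → ℚ) (t : ℕ → Γ) : ℚ :=
  polyEval M (m - b) (fun j => y (skip b k j)) (fun j => t (skip b (k + 1) j)) *
    polyEval N b (fun j => y (k + 1 + j)) (fun j => t (k + 1 + j))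

theorem polyEval_aritU (A B : Mould Γ) (m : ℕ) (y : ℕ → ℚ) (t : ℕ → Γ) :
    polyEval (aritU B A) m y t =
      ∑ b ∈ Finset.Ico 1 m, ∑ k ∈ Finset.range (m - b),
        (rightTerm A B m b k y t - leftTerm A B m b k y t) := by
  simp only [Finset.sum_sub_distrib]
  unfold polyEval seqEval aritU
  congr 1
  · rw [sum_blocks]
    refine Finset.sum_congr rfl fun b hb => Finset.sum_congr rfl fun k hk => ?_
    rw [Finset.mem_Ico] at hb
    rw [Finset.mem_range] at hk
    unfold rightTerm polyEval
    have e : k + b - 1 - k + 1 = b := by omega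
    congr 1
    · refine eq_seqEval A (congrArg (m - ·) e) (fun j hj => ?_) (fun j hj => ?_) <;> dsimp only
      · rw [e] at hj
        simp only [e, skip]
        split_ifs <;> (try omega) <;> rw [extG_of_lt (fun j => t (j + 1) * (t 0)⁻¹) (by omega)] <;>
          congr 2 <;> omega
      · rw [e] at hj
        simp only [e, skip]
        by_cases h1 : j < k
        · rw [if_pos h1, extQ_of_lt (fun j => y (j + 1) - y j) (by omega), if_pos (by omega),
            if_pos (by omega)]
        by_cases h2 : j = k
        · subst h2
          rw [if_neg h1, if_pos rfl, if_neg (by omega), if_pos (by omega)]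
          rw [Finset.sum_congr rfl fun i hi => extQ_of_lt (fun j => y (j + 1) - y j)
            (by rw [Finset.mem_Icc] at hi; omega), sum_Icc_sub y _ _ (by omega)]
          congr 2; omega
        · rw [if_neg h1, if_neg h2, extQ_of_lt (fun j => y (j + 1) - y j) (by omega),
            if_neg (by omega), if_neg (by omega)]
          congr 2; omega
    · refine eq_seqEval B e (fun j hj => ?_) (fun j hj => ?_) <;> dsimp only
      · rw [extG_of_lt (fun j => t (j + 1) * (t 0)⁻¹) (by omega),
          extG_of_lt (fun j => t (j + 1) * (t 0)⁻¹) (by omega)]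
        simp only [rebase, Nat.add_eq_zero_iff, one_ne_zero, and_false, if_false, if_true]
        rw [show k + b - 1 + 1 + 1 = k + b + 1 by omega, show k + (j + 1) = k + j + 1 by omega]
        group
      · rw [extQ_of_lt (fun j => y (j + 1) - y j) (by omega)]
        rfl
  · rw [sum_blocks_succ]
    refine Finset.sum_congr rfl fun b hb => Finset.sum_congr rfl fun k hk => ?_
    rw [Finset.mem_Ico] at hb
    rw [Finset.mem_range] at hk
    unfold leftTerm polyEval
    have e : k + b - (k + 1) + 1 = b := by omega
    congr 1
    · refine eq_seqEval A (congrArg (m - ·) e) (fun j hj => ?_) (fun j hj => ?_) <;> dsimp only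
      · rw [e] at hj
        simp only [e, skip]
        split_ifs <;> (try omega) <;> rw [extG_of_lt (fun j => t (j + 1) * (t 0)⁻¹) (by omega)] <;>
          congr 2 <;> omega
      · rw [e] at hj
        simp only [e, skip, Nat.add_sub_cancel]
        by_cases h1 : j < k
        · rw [if_pos h1, extQ_of_lt (fun j => y (j + 1) - y j) (by omega), if_pos (by omega),
            if_pos (by omega)]
        by_cases h2 : j = k
        · subst h2
          rw [if_neg h1, if_pos rfl, if_neg (by omega), if_pos (by omega)]
          rw [Finset.sum_congr rfl fun i hi => extQ_of_lt (fun j => y (j + 1) - y j)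
            (by rw [Finset.mem_Icc] at hi; omega), sum_Icc_sub y _ _ (by omega)]
          congr 2; omega
        · rw [if_neg h1, if_neg h2, extQ_of_lt (fun j => y (j + 1) - y j) (by omega),
            if_neg (by omega), if_neg (by omega)]
          congr 2; omega
    · refine eq_seqEval B e (fun j hj => ?_) (fun j hj => ?_) <;> dsimp only
      · rw [extG_of_lt (fun j => t (j + 1) * (t 0)⁻¹) (by omega),
          extG_of_lt (fun j => t (j + 1) * (t 0)⁻¹) (by omega)]
        simp only [Nat.add_sub_cancel, add_zero, ← add_assoc]
        group
      · rw [extQ_of_lt (fun j => y (j + 1) - y j) (by omega)]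
        rfl

/-- The summand of the product `M × N` whose second factor has depth `b`. -/
def mulTerm (M N : Mould Γ) (m b : ℕ) (y : ℕ → ℚ) (t : ℕ → Γ) : ℚ :=
  polyEval M (m - b) y t *
    polyEval N b (fun j => y (m - b + j)) (rebase (t 0) fun j => t (m - b + j))

theorem polyEval_mouldMul {A B : Mould Γ} (hA : IsARI A) (hB : IsARI B) (m : ℕ)
    (y : ℕ → ℚ) (t : ℕ → Γ) :
    polyEval (mouldMul A B) m y t = ∑ b ∈ Finset.Ico 1 m, mulTerm A B m b y t := by
  have key : polyEval (mouldMul A B) m y t = ∑ b ∈ Finset.range (m + 1), mulTerm A B m b y t := by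
    rw [← Finset.sum_range_reflect]
    unfold polyEval seqEval mouldMul
    refine Finset.sum_congr rfl fun i hi => ?_
    rw [Finset.mem_range] at hi
    unfold mulTerm polyEval
    have e : m - (m + 1 - 1 - i) = i := by omega
    rw [e]
    congr 1
    · refine eq_seqEval A rfl (fun j hj => ?_) (fun j hj => ?_) <;> dsimp only
      · rw [extG_of_lt (fun j => t (j + 1) * (t 0)⁻¹) (by omega)]
      · rw [extQ_of_lt (fun j => y (j + 1) - y j) (by omega)]
    · refine eq_seqEval B (by omega) (fun j hj => ?_) (fun j hj => ?_) <;> dsimp only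
      · rw [extG_of_lt (fun j => t (j + 1) * (t 0)⁻¹) (by omega)]
        rfl
      · rw [extQ_of_lt (fun j => y (j + 1) - y j) (by omega)]
        rfl
  rw [key, ← Finset.sum_subset (s₁ := Finset.Ico 1 m)]
  · intro b hb
    rw [Finset.mem_Ico] at hb
    rw [Finset.mem_range]
    omega
  · intro b hb hb'
    rw [Finset.mem_range] at hb
    rw [Finset.mem_Ico] at hb'
    obtain rfl | rfl : b = 0 ∨ b = m := by omega
    · rw [mulTerm, polyEval_zero hB, mul_zero]
    · rw [mulTerm, Nat.sub_self, polyEval_zero hA, zero_mul]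

theorem polyEval_ariU (A B : Mould Γ) (m : ℕ) (y : ℕ → ℚ) (t : ℕ → Γ) :
    polyEval (ariU A B) m y t = polyEval (aritU B A) m y t - polyEval (aritU A B) m y t +
      polyEval (mouldMul A B) m y t - polyEval (mouldMul B A) m y t := rfl

theorem polyEval_pushM (M : Mould Γ) (n : ℕ) (y : ℕ → ℚ) (t : ℕ → Γ) :
    polyEval (pushM M) n y t = polyEval M n (seqCons (y n) y) (seqCons (t n) t) := by
  unfold polyEval seqEval pushM
  congr 1 <;> funext ⟨j, hj⟩
  · rw [extG_of_lt (fun j => t (j + 1) * (t 0)⁻¹) (by omega)]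
    obtain ⟨n, rfl⟩ : ∃ n', n = n' + 1 := ⟨n - 1, by omega⟩
    cases j with
    | zero => simp
    | succ j =>
      rw [extG_of_lt (fun j => t (j + 1) * (t 0)⁻¹) (by simp; omega)]
      simp
  · cases j with
    | zero =>
      rw [Finset.sum_congr rfl fun i hi => extQ_of_lt (fun j => y (j + 1) - y j)
        (Finset.mem_range.1 hi), Finset.sum_range_sub]
      simp
    | succ j =>
      rw [extQ_of_lt (fun j => y (j + 1) - y j) (by simp; omega)]
      simp

theorem polyEval_rotate {M : Mould Γ} (hM : pushM M = M) (n r : ℕ) (y : ℕ → ℚ) (t : ℕ → Γ) :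
    polyEval M n y t =
      polyEval M n (fun j => y ((j + r) % (n + 1))) (fun j => t ((j + r) % (n + 1))) := by
  induction r with
  | zero =>
    refine polyEval_congr M (fun j hj => ?_) (fun j hj => ?_) <;>
      rw [add_zero, Nat.mod_eq_of_lt (by omega)]
  | succ r ih =>
    rw [ih]
    conv_rhs => rw [← hM, polyEval_pushM]
    refine polyEval_congr M (fun j hj => ?_) (fun j hj => ?_) <;> cases j
    · rw [seqCons_zero, show n + (r + 1) = 0 + r + (n + 1) by omega, Nat.add_mod_right]
    · rw [seqCons_succ]; congr 2; omega
    · rw [seqCons_zero, show n + (r + 1) = 0 + r + (n + 1) by omega, Nat.add_mod_right]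
    · rw [seqCons_succ]; congr 2; omega

theorem rightTerm_eq {A : Mould Γ} (B : Mould Γ) (hA : pushM A = A) {m b k : ℕ}
    (hk : k + b < m) {y : ℕ → ℚ} {t : ℕ → Γ}
    (hy : ∀ j, y (j + (m + 1)) = y j) (ht : ∀ j, t (j + (m + 1)) = t j) :
    rightTerm A B m b k y t =
      mulTerm A B m b (fun j => y (k + b + 1 + j)) (fun j => t (k + b + 1 + j)) := by
  have idx : ∀ j ≤ m - b, skip b k ((j + (k + 1)) % (m - b + 1)) = k + b + 1 + j ∨
      skip b k ((j + (k + 1)) % (m - b + 1)) + (m + 1) = k + b + 1 + j := by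
    intro j hj
    unfold skip
    rcases lt_or_ge (j + (k + 1)) (m - b + 1) with h | h
    · rw [Nat.mod_eq_of_lt h, if_neg (by omega)]; omega
    · rw [Nat.mod_eq_sub_mod h, Nat.mod_eq_of_lt (by omega), if_pos (by omega)]; omega
  unfold rightTerm mulTerm
  rw [polyEval_rotate hA _ (k + 1)]
  congr 1
  · refine polyEval_congr A (fun j hj => ?_) (fun j hj => ?_)
    · rcases idx j hj with h | h
      · rw [h]
      · rw [← hy, h]
    · rcases idx j hj with h | h
      · rw [h]
      · rw [← ht, h]
  · refine polyEval_congr B (fun j hj => ?_) (fun j hj => ?_)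
    · rw [← hy]; congr 1; omega
    · simp only [rebase, add_zero]
      congr 1
      rw [← ht]; congr 1; omega

theorem leftTerm_eq {A : Mould Γ} (B : Mould Γ) (hA : pushM A = A) {m b k : ℕ}
    (hk : k + b < m) {y : ℕ → ℚ} {t : ℕ → Γ}
    (hy : ∀ j, y (j + (m + 1)) = y j) (ht : ∀ j, t (j + (m + 1)) = t j) :
    leftTerm A B m b k y t =
      mulTerm B A m (m - b) (fun j => y (k + 1 + j)) (fun j => t (k + 1 + j)) := by
  have idx : ∀ j ≤ m - b, skip b k ((j + (k + 1)) % (m - b + 1)) = k + 1 + (b + j) ∨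
      skip b k ((j + (k + 1)) % (m - b + 1)) + (m + 1) = k + 1 + (b + j) := by
    intro j hj
    unfold skip
    rcases lt_or_ge (j + (k + 1)) (m - b + 1) with h | h
    · rw [Nat.mod_eq_of_lt h, if_neg (by omega)]; omega
    · rw [Nat.mod_eq_sub_mod h, Nat.mod_eq_of_lt (by omega), if_pos (by omega)]; omega
  have idx' : ∀ j ≤ m - b, j ≠ 0 →
      skip b (k + 1) ((j + (k + 1)) % (m - b + 1)) = k + 1 + (b + j) ∨
      skip b (k + 1) ((j + (k + 1)) % (m - b + 1)) + (m + 1) = k + 1 + (b + j) := by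
    intro j hj hj0
    unfold skip
    rcases lt_or_ge (j + (k + 1)) (m - b + 1) with h | h
    · rw [Nat.mod_eq_of_lt h, if_neg (by omega)]; omega
    · rw [Nat.mod_eq_sub_mod h, Nat.mod_eq_of_lt (by omega), if_pos (by omega)]; omega
  unfold leftTerm mulTerm
  rw [polyEval_rotate hA _ (k + 1), mul_comm, show m - (m - b) = b by omega]
  congr 1
  refine polyEval_congr A (fun j hj => ?_) (fun j hj => ?_)
  · rcases idx j hj with h | h
    · rw [h]
    · rw [← hy, h]
  · unfold rebase
    split_ifs with h0
    · subst h0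
      rw [Nat.mod_eq_of_lt (by omega), skip, if_pos (by omega)]
      congr 1; omega
    · rcases idx' j hj h0 with h | h
      · rw [h]
      · rw [← ht, h]

theorem sum_split_blocks (m : ℕ) (f : ℕ → ℕ → ℚ) :
    (∑ b ∈ Finset.Ico 1 m, ∑ r ∈ Finset.range (m + 1), f r b) =
      (∑ b ∈ Finset.Ico 1 m, ∑ k ∈ Finset.range (m - b), f (k + b + 1) b) +
      (∑ b ∈ Finset.Ico 1 m, ∑ k ∈ Finset.range (m - b), f (k + 1) (m - b)) +
      ∑ b ∈ Finset.Ico 1 m, f 0 b := by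
  have reflect : (∑ b ∈ Finset.Ico 1 m, ∑ k ∈ Finset.range (m - b), f (k + 1) (m - b)) =
      ∑ b ∈ Finset.Ico 1 m, ∑ k ∈ Finset.range b, f (k + 1) b := by
    refine Finset.sum_bij' (fun b _ => m - b) (fun b _ => m - b) ?_ ?_ ?_ ?_ ?_ <;>
      intro b hb <;> rw [Finset.mem_Ico] at hb
    · rw [Finset.mem_Ico]; omega
    · rw [Finset.mem_Ico]; omega
    · show m - (m - b) = b
      omega
    · show m - (m - b) = b
      omega
  rw [reflect, ← Finset.sum_add_distrib, ← Finset.sum_add_distrib]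
  refine Finset.sum_congr rfl fun b hb => ?_
  rw [Finset.mem_Ico] at hb
  rw [Finset.sum_range_succ']
  congr 1
  have := Finset.sum_range_add (fun k => f (k + 1) b) b (m - b)
  rw [show b + (m - b) = m by omega] at this
  rw [this, add_comm]
  congr 1
  exact Finset.sum_congr rfl fun k _ => by rw [add_comm b k]

theorem polyEval_ariU_eq_sum_rotations {A B : Mould Γ} (hA : IsARI A) (hB : IsARI B)
    (hApush : pushM A = A) (hBpush : pushM B = B) (m : ℕ) {y : ℕ → ℚ} {t : ℕ → Γ}
    (hy : ∀ j, y (j + (m + 1)) = y j) (ht : ∀ j, t (j + (m + 1)) = t j) :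
    polyEval (ariU A B) m y t = ∑ b ∈ Finset.Ico 1 m, ∑ r ∈ Finset.range (m + 1),
      (mulTerm A B m b (fun j => y (r + j)) (fun j => t (r + j)) -
        mulTerm B A m b (fun j => y (r + j)) (fun j => t (r + j))) := by
  have hR : ∀ {A : Mould Γ} (B : Mould Γ), pushM A = A →
      polyEval (aritU B A) m y t = ∑ b ∈ Finset.Ico 1 m, ∑ k ∈ Finset.range (m - b),
        (mulTerm A B m b (fun j => y (k + b + 1 + j)) (fun j => t (k + b + 1 + j)) -
         mulTerm B A m (m - b) (fun j => y (k + 1 + j)) (fun j => t (k + 1 + j))) := by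
    intro A B hA
    rw [polyEval_aritU]
    refine Finset.sum_congr rfl fun b hb => Finset.sum_congr rfl fun k hk => ?_
    rw [Finset.mem_Ico] at hb
    rw [Finset.mem_range] at hk
    rw [rightTerm_eq B hA (by omega) hy ht, leftTerm_eq B hA (by omega) hy ht]
  rw [polyEval_ariU, hR B hApush, hR A hBpush, polyEval_mouldMul hA hB, polyEval_mouldMul hB hA]
  simp only [Finset.sum_sub_distrib]
  rw [sum_split_blocks m fun r b => mulTerm A B m b (fun j => y (r + j)) (fun j => t (r + j)),
    sum_split_blocks m fun r b => mulTerm B A m b (fun j => y (r + j)) (fun j => t (r + j))]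
  simp only [zero_add]
  ring

theorem sum_range_shift {n : ℕ} {h : ℕ → ℚ} (hh : ∀ s, h (s + n) = h s) (r : ℕ) :
    ∑ s ∈ Finset.range n, h (s + r) = ∑ s ∈ Finset.range n, h s := by
  induction r with
  | zero => rfl
  | succ r ih =>
    rw [← ih]
    have h1 := Finset.sum_range_succ' (fun s => h (s + r)) n
    rw [Finset.sum_range_succ, add_comm n r, hh, zero_add] at h1
    rw [add_right_cancel h1]
    exact Finset.sum_congr rfl fun s _ => by congr 1; omega

theorem pushM_ariU {A B : Mould Γ} (hA : IsARI A) (hB : IsARI B)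
    (hApush : pushM A = A) (hBpush : pushM B = B) : pushM (ariU A B) = ariU A B := by
  funext m σ x
  rw [eq_polyEval (pushM _), eq_polyEval (ariU A B)]
  generalize (fun j => ∑ i ∈ Finset.range j, extQ x i) = y
  generalize seqCons 1 (extG σ) = t
  rw [polyEval_pushM]
  have e1 : polyEval (ariU A B) m y t =
      polyEval (ariU A B) m (fun j => y (j % (m + 1))) (fun j => t (j % (m + 1))) := by
    refine polyEval_congr _ (fun j hj => ?_) (fun j hj => ?_) <;>
      rw [Nat.mod_eq_of_lt (by omega)]
  have e2 : polyEval (ariU A B) m (seqCons (y m) y) (seqCons (t m) t) =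
      polyEval (ariU A B) m (fun j => y ((j + m) % (m + 1))) (fun j => t ((j + m) % (m + 1))) := by
    refine polyEval_congr _ (fun j hj => ?_) (fun j hj => ?_) <;> cases j with
    | zero => rw [seqCons_zero, zero_add, Nat.mod_eq_of_lt (by omega)]
    | succ j =>
      rw [seqCons_succ, show j + 1 + m = j + (m + 1) by omega, Nat.add_mod_right,
        Nat.mod_eq_of_lt (by omega)]
  rw [e1, e2, polyEval_ariU_eq_sum_rotations hA hB hApush hBpush,
    polyEval_ariU_eq_sum_rotations hA hB hApush hBpush]
  · refine Finset.sum_congr rfl fun b _ => ?_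
    refine (Finset.sum_congr rfl fun r _ => ?_).trans (sum_range_shift (n := m + 1)
      (h := fun r =>
        mulTerm A B m b (fun j => y ((r + j) % (m + 1))) (fun j => t ((r + j) % (m + 1))) -
        mulTerm B A m b (fun j => y ((r + j) % (m + 1))) (fun j => t ((r + j) % (m + 1)))) ?_ m)
    · simp only [add_right_comm r _ m]
    · intro s
      simp only [add_right_comm _ (m + 1), Nat.add_mod_right]
  · intro j; rw [Nat.add_mod_right]
  · intro j; rw [Nat.add_mod_right]
  · intro j; rw [add_right_comm, Nat.add_mod_right]
  · intro j; rw [add_right_comm, Nat.add_mod_right]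

/-- The mould `M` on the polygon with distinguished vertex `c` and further vertices
`w s, …, w (s + n - 1)`; these are the values of `swapM M` in potential coordinates. -/
def cutEval (M : Mould Γ) (n : ℕ) (c : ℚ) (w : ℕ → ℚ) (θ : ℕ → Γ) (s : ℕ) : ℚ :=
  polyEval M n (seqCons c fun j => w (s + j)) (seqCons (θ (s + n)) fun j => θ (s + j))

theorem cutEval_add_period (M : Mould Γ) {m : ℕ} (n : ℕ) (c : ℚ) {w : ℕ → ℚ} {θ : ℕ → Γ} {g : Γ}
    (hw : ∀ k, w (k + m) = w k) (hθ : ∀ k, θ (k + m) = θ k * g) (s : ℕ) :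
    cutEval M n c w θ (s + m) = cutEval M n c w θ s := by
  refine polyEval_congr_smul M g (fun j _ => ?_) (fun j _ => ?_) <;> cases j
  · rfl
  · simp only [seqCons_succ, add_right_comm s m, hw]
  · simp only [seqCons_zero, add_right_comm s m, hθ]
  · simp only [seqCons_succ, add_right_comm s m, hθ]

theorem swapM_cyclic_eq_cutEval (M : Mould Γ) {n : ℕ} (c : ℚ) {w : ℕ → ℚ} {θ : ℕ → Γ} {g : Γ}
    (hw : ∀ k, w (k + n) = w k) (hθ : ∀ k, θ (k + n) = θ k * g)
    {σ : Fin n → Γ} {v : Fin n → ℚ}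
    (hσ : ∀ q < n, extG σ q = θ (n - 1 - q) * (θ (n - q))⁻¹)
    (hv : ∀ q < n, extQ v q = w (n - 1 - q) - c) {i : ℕ} (hi : i < n) :
    swapM M n (fun j => extG σ ((i + j.val) % n)) (fun j => extQ v ((i + j.val) % n)) =
      cutEval M n c w θ (n - i) := by
  have hσ' : ∀ q < n, extG (fun j : Fin n => extG σ ((i + j.val) % n)) q =
      θ (n - i + (n - (q + 1))) * (θ (n - i + (n - q)))⁻¹ := by
    intro q hq
    rw [extG_of_lt (fun j => extG σ ((i + j) % n)) hq]
    rcases lt_or_ge (i + q) n with h | h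
    · rw [Nat.mod_eq_of_lt h, hσ _ h, show n - i + (n - (q + 1)) = n - 1 - (i + q) + n by omega,
        show n - i + (n - q) = n - (i + q) + n by omega, hθ, hθ]
      group
    · rw [Nat.mod_eq_sub_mod h, Nat.mod_eq_of_lt (by omega), hσ _ (by omega)]
      congr 3 <;> omega
  have hprod : ∀ p ≤ n, ∏ q ∈ Finset.range p,
      extG (fun j : Fin n => extG σ ((i + j.val) % n)) q =
        θ (n - i + (n - p)) * (θ (n - i + n))⁻¹ := by
    intro p
    induction p with
    | zero => intro _; simp
    | succ p ih =>
      intro hp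
      rw [Finset.prod_range_succ, ih (by omega), hσ' p (by omega), mul_comm]
      group
  have hv' : ∀ q < n, extQ (fun j : Fin n => extQ v ((i + j.val) % n)) q =
      w (n - i + (n - (q + 1))) - c := by
    intro q hq
    rw [extQ_of_lt (fun j => extQ v ((i + j) % n)) hq]
    rcases lt_or_ge (i + q) n with h | h
    · rw [Nat.mod_eq_of_lt h, hv _ h, show n - i + (n - (q + 1)) = n - 1 - (i + q) + n by omega,
        hw]
    · rw [Nat.mod_eq_sub_mod h, Nat.mod_eq_of_lt (by omega), hv _ (by omega)]
      congr 2; omega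
  unfold swapM cutEval polyEval
  refine eq_seqEval M rfl (fun j hj => ?_) (fun j hj => ?_) <;> dsimp only
  · rw [hprod _ (by omega), show n - (n - j) = j by omega]
    rfl
  · rw [hv' _ (by omega), show n - (n - 1 - j + 1) = j by omega]
    cases j with
    | zero => simp [extQ]
    | succ j =>
      rw [hv' _ (by omega), show n - (n - (j + 1) + 1) = j by omega]
      simp

theorem sum_swapM_cyclic (M : Mould Γ) {n : ℕ} (c : ℚ) {w : ℕ → ℚ} {θ : ℕ → Γ} {g : Γ}
    (hw : ∀ k, w (k + n) = w k) (hθ : ∀ k, θ (k + n) = θ k * g)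
    {σ : Fin n → Γ} {v : Fin n → ℚ}
    (hσ : ∀ q < n, extG σ q = θ (n - 1 - q) * (θ (n - q))⁻¹)
    (hv : ∀ q < n, extQ v q = w (n - 1 - q) - c) :
    ∑ i ∈ Finset.range n,
      swapM M n (fun j => extG σ ((i + j.val) % n)) (fun j => extQ v ((i + j.val) % n)) =
    ∑ s ∈ Finset.range n, cutEval M n c w θ s := by
  rw [← sum_range_shift (cutEval_add_period M n c hw hθ) 1, ← Finset.sum_range_reflect]
  refine Finset.sum_congr rfl fun i hi => ?_
  rw [Finset.mem_range] at hi
  rw [swapM_cyclic_eq_cutEval M c hw hθ hσ hv (by omega)]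
  congr 1; omega

theorem sum_cutEval_eq_zero {M : Mould Γ} (hM : IsPusNeutral (swapM M)) {n : ℕ} (hn : 1 ≤ n)
    (c : ℚ) {w : ℕ → ℚ} {θ : ℕ → Γ} {g : Γ}
    (hw : ∀ k, w (k + n) = w k) (hθ : ∀ k, θ (k + n) = θ k * g) :
    ∑ s ∈ Finset.range n, cutEval M n c w θ s = 0 := by
  rw [← hM n hn (fun q => θ (n - 1 - q.val) * (θ (n - q.val))⁻¹)
    (fun q => w (n - 1 - q.val) - c)]
  refine (sum_swapM_cyclic M c hw hθ (fun q hq => ?_) (fun q hq => ?_)).symm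
  · rw [extG_of_lt (fun q => θ (n - 1 - q) * (θ (n - q))⁻¹) hq]
  · rw [extQ_of_lt (fun q => w (n - 1 - q) - c) hq]

theorem isPusNeutral_swapM {M : Mould Γ}
    (hM : ∀ (n : ℕ) (c : ℚ) (w : ℕ → ℚ) (θ : ℕ → Γ) (g : Γ), (∀ k, w (k + n) = w k) →
      (∀ k, θ (k + n) = θ k * g) → ∑ s ∈ Finset.range n, cutEval M n c w θ s = 0) :
    IsPusNeutral (swapM M) := by
  intro n hn σ v
  have hw : ∀ k, extQ v (n - 1 - (k + n) % n) = extQ v (n - 1 - k % n) := fun k => by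
    rw [Nat.add_mod_right]
  have hθ : ∀ k, ∏ q ∈ Finset.range (k + n), (extG σ (n - 1 - q % n))⁻¹ =
      (∏ q ∈ Finset.range k, (extG σ (n - 1 - q % n))⁻¹) *
        ∏ q ∈ Finset.range n, (extG σ (n - 1 - q % n))⁻¹ := fun k => by
    rw [add_comm k n, Finset.prod_range_add, mul_comm]
    simp only [Nat.add_mod_left]
  rw [← hM n 0 (fun k => extQ v (n - 1 - k % n))
    (fun k => ∏ q ∈ Finset.range k, (extG σ (n - 1 - q % n))⁻¹) _ hw hθ]
  refine sum_swapM_cyclic M 0 (w := fun k => extQ v (n - 1 - k % n))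
    (θ := fun k => ∏ q ∈ Finset.range k, (extG σ (n - 1 - q % n))⁻¹) hw hθ (fun q hq => ?_) (fun q hq => ?_)
  · rw [show n - q = n - 1 - q + 1 by omega, Finset.prod_range_succ,
      Nat.mod_eq_of_lt (by omega : n - 1 - q < n), show n - 1 - (n - 1 - q) = q by omega, mul_inv, inv_inv,
      mul_inv_cancel_left]
  · rw [Nat.mod_eq_of_lt (by omega : n - 1 - q < n), show n - 1 - (n - 1 - q) = q by omega,
      sub_zero]

theorem mulTerm_eq_rightTerm (A B : Mould Γ) {m b : ℕ} (hb : b ≤ m) {y : ℕ → ℚ} {t : ℕ → Γ}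
    (ht : t (m + 1) = t 0) : mulTerm A B m b y t = rightTerm A B m b (m - b) y t := by
  unfold mulTerm rightTerm
  rw [show m - b + b + 1 = m + 1 by omega, ht]
  congr 1
  refine polyEval_congr A (fun j hj => ?_) (fun j hj => ?_) <;> rw [skip, if_pos hj]

section Cut

variable {m : ℕ} (c : ℚ) {w : ℕ → ℚ} {θ : ℕ → Γ} {g : Γ}

theorem rightTerm_zero (A B : Mould Γ) {b : ℕ} (hb : 1 ≤ b ∧ b < m) (s : ℕ) :
    rightTerm A B m b 0 (seqCons c fun j => w (s + j)) (seqCons (θ (s + m)) fun j => θ (s + j)) =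
      cutEval A (m - b) c w θ (s + b) * cutEval B b c w θ s := by
  unfold rightTerm cutEval
  congr 1
  · refine polyEval_congr A (fun j hj => ?_) (fun j hj => ?_) <;> cases j with
    | zero => first | rfl | (show θ _ = θ _; congr 1; omega)
    | succ j =>
      rw [skip, if_neg (by omega), add_right_comm j 1 b]
      simp only [seqCons_succ]
      congr 1; omega
  · refine polyEval_congr B (fun j hj => ?_) (fun j hj => ?_)
    · rw [zero_add]
    · cases j with
      | zero => simp [rebase]
      | succ j => simp [rebase]

theorem rightTerm_add_period (A B : Mould Γ) (hw : ∀ k, w (k + m) = w k)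
    (hθ : ∀ k, θ (k + m) = θ k * g) (b k s : ℕ) :
    rightTerm A B m b k (seqCons c fun j => w (s + m + j))
      (seqCons (θ (s + m + m)) fun j => θ (s + m + j)) =
    rightTerm A B m b k (seqCons c fun j => w (s + j))
      (seqCons (θ (s + m)) fun j => θ (s + j)) := by
  have hy : (seqCons c fun j => w (s + m + j)) = seqCons c fun j => w (s + j) := by
    simp only [add_right_comm s m, hw]
  have ht : ∀ i, seqCons (θ (s + m + m)) (fun j => θ (s + m + j)) i =
      seqCons (θ (s + m)) (fun j => θ (s + j)) i * g := by
    rintro (_ | i)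
    · exact hθ _
    · simp only [seqCons_succ, add_right_comm s m, hθ]
  unfold rightTerm
  rw [hy]
  congr 1
  · exact polyEval_congr_smul A g (fun _ _ => rfl) fun j _ => ht _
  · refine polyEval_congr_smul B g (fun _ _ => rfl) fun j _ => ?_
    unfold rebase
    split_ifs <;> exact ht _

theorem leftTerm_add_period (A B : Mould Γ) (hw : ∀ k, w (k + m) = w k)
    (hθ : ∀ k, θ (k + m) = θ k * g) (b k s : ℕ) :
    leftTerm A B m b k (seqCons c fun j => w (s + m + j))
      (seqCons (θ (s + m + m)) fun j => θ (s + m + j)) =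
    leftTerm A B m b k (seqCons c fun j => w (s + j))
      (seqCons (θ (s + m)) fun j => θ (s + j)) := by
  have hy : (seqCons c fun j => w (s + m + j)) = seqCons c fun j => w (s + j) := by
    simp only [add_right_comm s m, hw]
  have ht : ∀ i, seqCons (θ (s + m + m)) (fun j => θ (s + m + j)) i =
      seqCons (θ (s + m)) (fun j => θ (s + j)) i * g := by
    rintro (_ | i)
    · exact hθ _
    · simp only [seqCons_succ, add_right_comm s m, hθ]
  unfold leftTerm
  rw [hy]
  congr 1
  · exact polyEval_congr_smul A g (fun _ _ => rfl) fun j _ => ht _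
  · exact polyEval_congr_smul B g (fun _ _ => rfl) fun j _ => ht _

theorem sum_cyclic_cuts_eq_zero {n : ℕ} {h : ℕ → ℕ → ℚ} (hper : ∀ k s, h k (s + m) = h k s)
    (r : ℕ) {N : ℕ → ℕ → ℚ} {P : ℕ → ℚ}
    (hN : ∀ s, ∑ t ∈ Finset.range n, N s t = 0)
    (hh : ∀ k t s, k + t + 1 = n → h k (s + (t + r)) = N s t * P s) :
    ∑ s ∈ Finset.range m, ∑ k ∈ Finset.range n, h k s = 0 := by
  have : ∀ k ∈ Finset.range n, ∑ s ∈ Finset.range m, h k s =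
      ∑ s ∈ Finset.range m, N s (n - 1 - k) * P s := by
    intro k hk
    rw [Finset.mem_range] at hk
    rw [← sum_range_shift (hper k) (n - 1 - k + r)]
    exact Finset.sum_congr rfl fun s _ => hh _ _ _ (by omega)
  rw [Finset.sum_comm, Finset.sum_congr rfl this, Finset.sum_comm]
  refine Finset.sum_eq_zero fun s _ => ?_
  rw [Finset.sum_range_reflect (fun t => N s t * P s), ← Finset.sum_mul, hN, zero_mul]

theorem quasiperiodic_extension (f : ℕ → Γ) (g : Γ) {n : ℕ} (hn : 1 ≤ n) (k : ℕ) :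
    f ((k + n) % n) * g ^ ((k + n) / n) = f (k % n) * g ^ (k / n) * g := by
  rw [Nat.add_mod_right, Nat.add_div_right _ hn, pow_succ, mul_assoc]

theorem sum_rightTerm_succ {A : Mould Γ} (B : Mould Γ) (hA : IsPusNeutral (swapM A))
    (hw : ∀ k, w (k + m) = w k) (hθ : ∀ k, θ (k + m) = θ k * g) {b : ℕ} (hb : 1 ≤ b ∧ b < m) :
    ∑ s ∈ Finset.range m, ∑ k ∈ Finset.range (m - b),
      rightTerm A B m b (k + 1) (seqCons c fun j => w (s + j))
        (seqCons (θ (s + m)) fun j => θ (s + j)) = 0 := by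
  refine sum_cyclic_cuts_eq_zero (r := 0)
    (h := fun k s => rightTerm A B m b (k + 1) (seqCons c fun j => w (s + j))
      (seqCons (θ (s + m)) fun j => θ (s + j)))
    (N := fun s => cutEval A (m - b) c (fun i => w (s + i % (m - b)))
      (fun i => θ (s + i % (m - b)) * g ^ (i / (m - b))))
    (P := fun s => polyEval B b (fun j => w (s + (m - b - 1) + j))
      (rebase (θ (s + m)) fun j => θ (s + (m - b - 1) + j)))
    (fun k s => rightTerm_add_period c A B hw hθ b (k + 1) s)
    (fun s => sum_cutEval_eq_zero hA (by omega) c (fun k => by rw [Nat.add_mod_right])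
      (quasiperiodic_extension (fun i => θ (s + i)) g (by omega))) ?_
  intro k t s hkt
  have hdiv : ∀ i, m - b ≤ i → i < 2 * (m - b) → i % (m - b) = i - (m - b) ∧ i / (m - b) = 1 := by
    intro i h1 h2
    exact ⟨by rw [Nat.mod_eq_sub_mod h1, Nat.mod_eq_of_lt (by omega)],
      Nat.div_eq_of_lt_le (by omega) (by omega)⟩
  unfold rightTerm cutEval
  congr 1
  · refine polyEval_congr A (fun j hj => ?_) (fun j hj => ?_)
    · cases j with
      | zero => rfl
      | succ j =>
        unfold skip
        split_ifs with h
        · simp only [seqCons_succ]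
          rw [Nat.mod_eq_of_lt (by omega)]
          congr 1; omega
        · rw [add_right_comm j 1 b]
          simp only [seqCons_succ]
          rw [(hdiv (t + j) (by omega) (by omega)).1, ← hw (s + (t + j - (m - b)))]
          congr 1; omega
    · cases j with
      | zero =>
        rw [skip, if_pos (by omega), seqCons_zero, seqCons_zero]
        dsimp only
        rw [(hdiv (t + (m - b)) (by omega) (by omega)).1,
          (hdiv (t + (m - b)) (by omega) (by omega)).2, pow_one, ← hθ]
        congr 1; omega
      | succ j =>
        unfold skip
        split_ifs with h
        · simp only [seqCons_succ]
          rw [Nat.mod_eq_of_lt (by omega), Nat.div_eq_of_lt (by omega), pow_zero, mul_one]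
          congr 1; omega
        · rw [add_right_comm j 1 b]
          simp only [seqCons_succ]
          rw [(hdiv (t + j) (by omega) (by omega)).1, (hdiv (t + j) (by omega) (by omega)).2,
            pow_one, ← hθ]
          congr 1; omega
  · refine polyEval_congr B (fun j hj => ?_) (fun j hj => ?_)
    · rw [add_right_comm k 1 j, seqCons_succ]
      congr 1; omega
    · unfold rebase
      split_ifs with h
      · rw [seqCons_succ]
        congr 1; omega
      · dsimp only
        rw [add_right_comm k 1 j, seqCons_succ]
        congr 1; omega

theorem sum_leftTerm {A : Mould Γ} (B : Mould Γ) (hA : IsPusNeutral (swapM A))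
    (hw : ∀ k, w (k + m) = w k) (hθ : ∀ k, θ (k + m) = θ k * g) {b : ℕ} (hb : 1 ≤ b ∧ b < m) :
    ∑ s ∈ Finset.range m, ∑ k ∈ Finset.range (m - b),
      leftTerm A B m b k (seqCons c fun j => w (s + j))
        (seqCons (θ (s + m)) fun j => θ (s + j)) = 0 := by
  refine sum_cyclic_cuts_eq_zero (r := 1)
    (h := fun k s => leftTerm A B m b k (seqCons c fun j => w (s + j))
      (seqCons (θ (s + m)) fun j => θ (s + j)))
    (N := fun s => cutEval A (m - b) c (fun i => w (s + (i + 1) % (m - b)))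
      (fun i => θ (s + 1 + i % (m - b)) * g ^ (i / (m - b))))
    (P := fun s => polyEval B b (fun j => w (s + (m - b) + j)) (fun j => θ (s + (m - b) + j)))
    (fun k s => leftTerm_add_period c A B hw hθ b k s)
    (fun s => sum_cutEval_eq_zero hA (by omega) c
      (fun k => by rw [add_right_comm, Nat.add_mod_right])
      (quasiperiodic_extension (fun i => θ (s + 1 + i)) g (by omega))) ?_
  intro k t s hkt
  have hdiv : ∀ i, m - b ≤ i → i < 2 * (m - b) → i % (m - b) = i - (m - b) ∧ i / (m - b) = 1 := by
    intro i h1 h2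
    exact ⟨by rw [Nat.mod_eq_sub_mod h1, Nat.mod_eq_of_lt (by omega)],
      Nat.div_eq_of_lt_le (by omega) (by omega)⟩
  unfold leftTerm cutEval
  congr 1
  · refine polyEval_congr A (fun j hj => ?_) (fun j hj => ?_)
    · cases j with
      | zero => rfl
      | succ j =>
        unfold skip
        split_ifs with h
        · simp only [seqCons_succ]
          rw [Nat.mod_eq_of_lt (by omega)]
          congr 1; omega
        · rw [add_right_comm j 1 b]
          simp only [seqCons_succ]
          rw [(hdiv (t + j + 1) (by omega) (by omega)).1, ← hw (s + (t + j + 1 - (m - b)))]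
          congr 1; omega
    · cases j with
      | zero =>
        rw [skip, if_pos (by omega), seqCons_zero, seqCons_zero]
        dsimp only
        rw [(hdiv (t + (m - b)) (by omega) (by omega)).1,
          (hdiv (t + (m - b)) (by omega) (by omega)).2, pow_one, ← hθ]
        congr 1; omega
      | succ j =>
        unfold skip
        split_ifs with h
        · simp only [seqCons_succ]
          rw [Nat.mod_eq_of_lt (by omega), Nat.div_eq_of_lt (by omega), pow_zero, mul_one]
          congr 1; omega
        · rw [add_right_comm j 1 b]
          simp only [seqCons_succ]
          rw [(hdiv (t + j) (by omega) (by omega)).1, (hdiv (t + j) (by omega) (by omega)).2,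
            pow_one, ← hθ]
          congr 1; omega
  · refine polyEval_congr B (fun j hj => ?_) (fun j hj => ?_) <;>
      rw [add_right_comm k 1 j, seqCons_succ] <;> congr 1 <;> omega

theorem sum_cutEval_preariU {A B : Mould Γ} (hA : IsARI A) (hB : IsARI B)
    (hApn : IsPusNeutral (swapM A)) (hw : ∀ k, w (k + m) = w k)
    (hθ : ∀ k, θ (k + m) = θ k * g) :
    ∑ s ∈ Finset.range m, cutEval (preariU A B) m c w θ s =
      ∑ b ∈ Finset.Ico 1 m, ∑ s ∈ Finset.range m,
        cutEval A (m - b) c w θ (s + b) * cutEval B b c w θ s := by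
  have key : ∀ s, cutEval (preariU A B) m c w θ s = ∑ b ∈ Finset.Ico 1 m,
      (cutEval A (m - b) c w θ (s + b) * cutEval B b c w θ s +
        ∑ k ∈ Finset.range (m - b), rightTerm A B m b (k + 1) (seqCons c fun j => w (s + j))
          (seqCons (θ (s + m)) fun j => θ (s + j)) -
        ∑ k ∈ Finset.range (m - b), leftTerm A B m b k (seqCons c fun j => w (s + j))
          (seqCons (θ (s + m)) fun j => θ (s + j))) := by
    intro s
    change polyEval (aritU B A) m _ _ + polyEval (mouldMul A B) m _ _ = _
    rw [polyEval_aritU, polyEval_mouldMul hA hB, ← Finset.sum_add_distrib]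
    refine Finset.sum_congr rfl fun b hb => ?_
    rw [Finset.mem_Ico] at hb
    rw [mulTerm_eq_rightTerm A B hb.2.le rfl, Finset.sum_sub_distrib,
      ← rightTerm_zero c A B hb s, sub_add_eq_add_sub, ← Finset.sum_range_succ,
      Finset.sum_range_succ', add_comm (rightTerm A B m b 0 _ _)]
  rw [Finset.sum_congr rfl fun s _ => key s, Finset.sum_comm]
  refine Finset.sum_congr rfl fun b hb => ?_
  rw [Finset.mem_Ico] at hb
  rw [Finset.sum_sub_distrib, Finset.sum_add_distrib, sum_rightTerm_succ c B hApn hw hθ hb,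
    sum_leftTerm c B hApn hw hθ hb, add_zero, sub_zero]

theorem sum_cutEval_mul_comm (A B : Mould Γ) (hw : ∀ k, w (k + m) = w k)
    (hθ : ∀ k, θ (k + m) = θ k * g) :
    ∑ b ∈ Finset.Ico 1 m, ∑ s ∈ Finset.range m,
        cutEval A (m - b) c w θ (s + b) * cutEval B b c w θ s =
      ∑ b ∈ Finset.Ico 1 m, ∑ s ∈ Finset.range m,
        cutEval B (m - b) c w θ (s + b) * cutEval A b c w θ s := by
  refine Finset.sum_bij' (fun b _ => m - b) (fun b _ => m - b) ?_ ?_ ?_ ?_ ?_ <;>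
    intro b hb <;> rw [Finset.mem_Ico] at hb
  · rw [Finset.mem_Ico]; omega
  · rw [Finset.mem_Ico]; omega
  · show m - (m - b) = b
    omega
  · show m - (m - b) = b
    omega
  · rw [← sum_range_shift (r := m - b)]
    · refine Finset.sum_congr rfl fun s _ => ?_
      rw [show s + (m - b) + b = s + m by omega, cutEval_add_period A _ c hw hθ, mul_comm,
        show m - (m - b) = b by omega]
    · intro s
      rw [add_right_comm, cutEval_add_period A _ c hw hθ, cutEval_add_period B _ c hw hθ]

end Cut

theorem isPusNeutral_swapM_ariU {A B : Mould Γ} (hA : IsARI A) (hB : IsARI B)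
    (hApn : IsPusNeutral (swapM A)) (hBpn : IsPusNeutral (swapM B)) :
    IsPusNeutral (swapM (ariU A B)) := by
  refine isPusNeutral_swapM fun m c w θ g hw hθ => ?_
  have hsub : ∀ s, cutEval (ariU A B) m c w θ s =
      cutEval (preariU A B) m c w θ s - cutEval (preariU B A) m c w θ s := by
    intro s
    change polyEval (ariU A B) m _ _ =
      (polyEval (aritU B A) m _ _ + polyEval (mouldMul A B) m _ _) -
        (polyEval (aritU A B) m _ _ + polyEval (mouldMul B A) m _ _)
    rw [polyEval_ariU]
    ring
  rw [Finset.sum_congr rfl fun s _ => hsub s, Finset.sum_sub_distrib,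
    sum_cutEval_preariU c hA hB hApn hw hθ, sum_cutEval_preariU c hB hA hBpn hw hθ,
    sum_cutEval_mul_comm c A B hw hθ, sub_self]

/-- Theorem: if `A, B ∈ ARI(Γ)` are push-invariant with pus-neutral swap,
then so is `ari_u(A,B)`; hence `ARI(Γ)_{push/pusnu}` is a Lie subalgebra. -/
theorem ariU_push_pusnu (Γ : Type) [CommGroup Γ] [Fintype Γ]
    (A B : Mould Γ) (hA : IsARI A) (hB : IsARI B)
    (hApush : pushM A = A) (hBpush : pushM B = B)
    (hApn : IsPusNeutral (swapM A)) (hBpn : IsPusNeutral (swapM B)) :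
    pushM (ariU A B) = ariU A B ∧ IsPusNeutral (swapM (ariU A B)) := by
  exact ⟨pushM_ariU hA hB hApush hBpush, isPusNeutral_swapM_ariU hA hB hApn hBpn⟩

end KVMould
end

section
/- Proposition: The subspace ARID(Γ) of moulds satisfying the distribution relations is a Lie subalgebra of (ARI(Γ), ari_u): if A, B ∈ ARID(Γ), then ari_u(A,B) ∈ ARID(Γ). -/
namespace KVMould

variable {Γ : Type} [CommGroup Γ]

lemma extG_pow {m : ℕ} (τ : Fin m → Γ) (N i : ℕ) : extG (τ ^ N) i = extG τ i ^ N := by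
  unfold extG
  split_ifs <;> simp

lemma extG_val {m : ℕ} (τ : Fin m → Γ) (i : Fin m) : extG τ i.val = τ i := by
  simp [extG]

lemma extQ_mul {m : ℕ} (c : ℚ) (x : Fin m → ℚ) (i : ℕ) :
    extQ (fun j => c * x j) i = c * extQ x i := by
  unfold extQ
  split_ifs <;> simp

section Distribution

variable [Fintype Γ] [DecidableEq Γ]

/-- The distribution relation of level `N`, with the index written as an explicit `N`-th power. -/
def DistributionAt (N : ℕ) (M : Mould Γ) : Prop :=
  ∀ (m : ℕ) (ρ : Fin m → Γ) (x : Fin m → ℚ),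
    M m (ρ ^ N) x =
      ∑ τ ∈ Finset.univ.filter (fun τ : Fin m → Γ => τ ^ N = ρ ^ N), M m τ (fun i => N * x i)

lemma iN_eq_mN_iff (N : ℕ) (M : Mould Γ) : iN N M = mN N M ↔ DistributionAt N M := by
  constructor
  · intro h m ρ x
    have := congrFun (congrFun (congrFun h m) (fun i => ⟨ρ i ^ N, ρ i, rfl⟩)) x
    simpa [iN, mN, funext_iff, Pi.pow_def] using this
  · intro h
    funext m σ x
    choose ρ hρ using fun i => (σ i).2
    have hσ : (fun i => (σ i : Γ)) = ρ ^ N := by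
      funext i
      exact (hρ i).symm
    have key := h m ρ x
    rw [← hσ] at key
    simpa [iN, mN, funext_iff] using key

/-- A product of two moulds whose index tuples jointly determine the full index tuple, compatibly
with `N`-th powers, inherits the distribution relation of its factors. -/
lemma DistributionAt.mul_eq_sum {N : ℕ} {A B : Mould Γ} (hA : DistributionAt N A)
    (hB : DistributionAt N B) {m a b : ℕ} (hab : a + b = m)
    (F : (Fin m → Γ) → Fin a → Γ) (G : (Fin m → Γ) → Fin b → Γ)
    (hF : ∀ τ, F (τ ^ N) = F τ ^ N) (hG : ∀ τ, G (τ ^ N) = G τ ^ N)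
    (hinj : ∀ τ τ', F τ = F τ' → G τ = G τ' → τ = τ')
    {y y' : Fin a → ℚ} {z z' : Fin b → ℚ} (hy : ∀ i, y' i = N * y i) (hz : ∀ i, z' i = N * z i)
    (ρ : Fin m → Γ) :
    A a (F (ρ ^ N)) y * B b (G (ρ ^ N)) z =
      ∑ τ ∈ Finset.univ.filter (fun τ : Fin m → Γ => τ ^ N = ρ ^ N),
        A a (F τ) y' * B b (G τ) z' := by
  have hbij : Function.Bijective (fun τ => (F τ, G τ)) := by
    rw [Fintype.bijective_iff_injective_and_card]
    refine ⟨fun τ τ' h => hinj τ τ' (congrArg Prod.fst h) (congrArg Prod.snd h), ?_⟩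
    simp [← hab, pow_add]
  rw [funext hy, funext hz, hF, hG, hA, hB, Finset.sum_mul_sum, ← Finset.sum_product']
  symm
  refine Finset.sum_bij (fun τ _ => (F τ, G τ)) ?_ (fun _ _ _ _ h => hbij.1 h) ?_ (fun _ _ => rfl)
  · intro τ hτ
    simp only [Finset.mem_filter, Finset.mem_univ, true_and] at hτ
    simp [← hF, ← hG, hτ]
  · rintro ⟨u, v⟩ huv
    obtain ⟨τ, hτ⟩ := hbij.2 (u, v)
    obtain ⟨rfl, rfl⟩ := Prod.mk.inj hτ
    simp only [Finset.mem_product, Finset.mem_filter, Finset.mem_univ, true_and, ← hF,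
      ← hG] at huv
    exact ⟨τ, by simpa using hinj _ _ huv.1 huv.2, rfl⟩

lemma DistributionAt.add {N : ℕ} {A B : Mould Γ} (hA : DistributionAt N A)
    (hB : DistributionAt N B) : DistributionAt N (A + B) := fun m ρ x => by
  simp only [Pi.add_apply, hA m ρ x, hB m ρ x, Finset.sum_add_distrib]

lemma DistributionAt.sub {N : ℕ} {A B : Mould Γ} (hA : DistributionAt N A)
    (hB : DistributionAt N B) : DistributionAt N (A - B) := fun m ρ x => by
  simp only [Pi.sub_apply, hA m ρ x, hB m ρ x, Finset.sum_sub_distrib]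

lemma DistributionAt.mouldMul {N : ℕ} {A B : Mould Γ} (hA : DistributionAt N A)
    (hB : DistributionAt N B) : DistributionAt N (mouldMul A B) := by
  intro m ρ x
  unfold KVMould.mouldMul
  rw [Finset.sum_comm]
  refine Finset.sum_congr rfl fun k hk => ?_
  have hk : k ≤ m := Nat.lt_succ_iff.mp (Finset.mem_range.mp hk)
  refine hA.mul_eq_sum hB (Nat.add_sub_cancel' hk)
    (fun τ j => extG τ j.val) (fun τ j => extG τ (k + j.val)) ?_ ?_ ?_ ?_ ?_ ρ
  · intro τ
    funext j
    simp [extG_pow]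
  · intro τ
    funext j
    simp [extG_pow]
  · intro τ τ' h₁ h₂
    funext i
    rw [← extG_val τ, ← extG_val τ']
    by_cases hi : i.val < k
    · exact congrFun h₁ ⟨i, hi⟩
    · have := congrFun h₂ ⟨i - k, by omega⟩
      simpa [Nat.add_sub_cancel' (not_lt.mp hi)] using this
  · simp [extQ_mul]
  · simp [extQ_mul]

lemma DistributionAt.aritU {N : ℕ} {A B : Mould Γ} (hA : DistributionAt N A)
    (hB : DistributionAt N B) : DistributionAt N (aritU B A) := by
  intro m ρ x
  unfold KVMould.aritU
  rw [Finset.sum_sub_distrib]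
  congr 1
  · refine Eq.trans ?_ Finset.sum_comm
    refine Finset.sum_congr rfl fun k _ => ?_
    refine Eq.trans ?_ Finset.sum_comm
    refine Finset.sum_congr rfl fun l _ => ?_
    split_ifs with h
    · obtain ⟨hkl, hlm⟩ := h
      refine hA.mul_eq_sum hB (by omega)
        (fun τ j => if j.val < k then extG τ j.val
          else if j.val = k then extG τ (l + 1)
          else extG τ (j.val + (l - k + 1)))
        (fun τ j => extG τ (k + j.val) * (extG τ (l + 1))⁻¹) ?_ ?_ ?_ ?_ ?_ ρ
      · intro τ
        funext j
        simp only [Pi.pow_apply, extG_pow]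
        split_ifs <;> rfl
      · intro τ
        funext j
        simp [extG_pow, mul_pow]
      · intro τ τ' h₁ h₂
        have hpivot : extG τ (l + 1) = extG τ' (l + 1) := by
          simpa using congrFun h₁ ⟨k, by omega⟩
        funext i
        rw [← extG_val τ, ← extG_val τ']
        by_cases hi : i.val < k
        · simpa [hi] using congrFun h₁ ⟨i, by omega⟩
        by_cases hi' : i.val ≤ l
        · have := congrFun h₂ ⟨i - k, by omega⟩
          simpa [hpivot, Nat.add_sub_cancel' (not_lt.mp hi)] using this
        by_cases hi'' : i.val = l + 1
        · rw [hi'', hpivot]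
        · have := congrFun h₁ ⟨i - (l - k + 1), by omega⟩
          have e : i.val - (l - k + 1) + (l - k + 1) = i.val := by omega
          simpa only [e, if_neg (show ¬ i.val - (l - k + 1) < k by omega),
            if_neg (show ¬ i.val - (l - k + 1) = k by omega)] using this
      · intro i
        simp only [extQ_mul, Finset.mul_sum, mul_ite]
      · simp [extQ_mul]
    · simp
  · refine Eq.trans ?_ Finset.sum_comm
    refine Finset.sum_congr rfl fun k _ => ?_
    refine Eq.trans ?_ Finset.sum_comm
    refine Finset.sum_congr rfl fun l hl => ?_
    have hlm := Finset.mem_range.mp hl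
    split_ifs with h
    · obtain ⟨hk, hkl⟩ := h
      refine hA.mul_eq_sum hB (by omega)
        (fun τ j => if j.val < k - 1 then extG τ j.val
          else if j.val = k - 1 then extG τ (k - 1)
          else extG τ (j.val + (l - k + 1)))
        (fun τ j => extG τ (k + j.val) * (extG τ (k - 1))⁻¹) ?_ ?_ ?_ ?_ ?_ ρ
      · intro τ
        funext j
        simp only [Pi.pow_apply, extG_pow]
        split_ifs <;> rfl
      · intro τ
        funext j
        simp [extG_pow, mul_pow]
      · intro τ τ' h₁ h₂
        have hpivot : extG τ (k - 1) = extG τ' (k - 1) := by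
          simpa using congrFun h₁ ⟨k - 1, by omega⟩
        funext i
        rw [← extG_val τ, ← extG_val τ']
        by_cases hi : i.val < k - 1
        · simpa [hi] using congrFun h₁ ⟨i, by omega⟩
        by_cases hi'' : i.val = k - 1
        · rw [hi'', hpivot]
        by_cases hi' : i.val ≤ l
        · have := congrFun h₂ ⟨i - k, by omega⟩
          simpa [hpivot, Nat.add_sub_cancel' (show k ≤ i.val by omega)] using this
        · have := congrFun h₁ ⟨i - (l - k + 1), by omega⟩
          have e : i.val - (l - k + 1) + (l - k + 1) = i.val := by omega
          simpa only [e, if_neg (show ¬ i.val - (l - k + 1) < k - 1 by omega),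
            if_neg (show ¬ i.val - (l - k + 1) = k - 1 by omega)] using this
      · intro i
        simp only [extQ_mul, Finset.mul_sum, mul_ite]
      · simp [extQ_mul]
    · simp

end Distribution

/-- Proposition: `ARID(Γ)` (the moulds satisfying the distribution relations)
is a Lie subalgebra of `(ARI(Γ), ari_u)`. -/
theorem ariU_ARID (Γ : Type) [CommGroup Γ] [Fintype Γ] [DecidableEq Γ]
    (A B : Mould Γ) (hA : IsARI A) (hB : IsARI B)
    (hAd : IsARID A) (hBd : IsARID B) :
    IsARID (ariU A B) := by
  intro N hN hdvd
  have hA' := (iN_eq_mN_iff N A).mp (hAd N hN hdvd)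
  have hB' := (iN_eq_mN_iff N B).mp (hBd N hN hdvd)
  exact (iN_eq_mN_iff N _).mpr
    ((((hA'.aritU hB').sub (hB'.aritU hA')).add (hA'.mouldMul hB')).sub (hB'.mouldMul hA'))

end KVMould
end
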